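/- arXiv:2510.11970 — 5 statements merged into one kernel-verified Lean document; each statement's English description precedes it below -/
import Mathlib

section
/- Let A and B be groups, and let δ_A and δ_B be automorphisms of A and B respectively with δ_A∘δ_A = id and δ_B∘δ_B = id. Form the free product G := (A ⋊ ⟨x₀⟩) * (B ⋊ ⟨y₀⟩), where ⟨x₀⟩ and ⟨y₀⟩ are cyclic groups of order 2 acting via δ_A and δ_B. Let φ : G → Z/2 be the homomorphism that kills A and B and sends both x₀ and y₀ to the generator of Z/2, and let H := ker φ. Then: (a) H is the internal free product of the subgroups A, B and the infinite cyclic subgroup generated by z := x₀y₀, so H ≅ A * B * ℤ; (b) G = H ⋊ ⟨x₀⟩; (c) conjugation by x₀ acts on H by δ_A on A, by b ↦ z·δ_B(b)·z⁻¹ on B, and sends z to z⁻¹. Consequently (A ⋊ Z/2) * (B ⋊ Z/2) ≅ (A * B * ℤ) ⋊ Z/2 with the described action. -/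
namespace Stmt0

variable {A B : Type*} [Group A] [Group B]
  (φA : Multiplicative (ZMod 2) →* MulAut A)
  (φB : Multiplicative (ZMod 2) →* MulAut B)

/-- The free product `G = (A ⋊ ⟨x₀⟩) ∗ (B ⋊ ⟨y₀⟩)`, where `⟨x₀⟩ = ⟨y₀⟩ = ℤ/2`. -/
abbrev G := Monoid.Coprod (A ⋊[φA] Multiplicative (ZMod 2)) (B ⋊[φB] Multiplicative (ZMod 2))

/-- The homomorphism `φ : G → ℤ/2` killing `A` and `B` and sending both `x₀` and `y₀` to
the generator of `ℤ/2`. -/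
def φ : G φA φB →* Multiplicative (ZMod 2) :=
  Monoid.Coprod.lift SemidirectProduct.rightHom SemidirectProduct.rightHom

/-- The element `x₀` of `G`. -/
def x₀ : G φA φB := Monoid.Coprod.inl (SemidirectProduct.inr (Multiplicative.ofAdd 1))

/-- The element `y₀` of `G`. -/
def y₀ : G φA φB := Monoid.Coprod.inr (SemidirectProduct.inr (Multiplicative.ofAdd 1))

/-- The element `z := x₀ y₀` of `G`. -/
def z : G φA φB := x₀ φA φB * y₀ φA φB

/-- The canonical embedding of `A` into `G`. -/
def ιA : A →* G φA φB := Monoid.Coprod.inl.comp SemidirectProduct.inl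

/-- The canonical embedding of `B` into `G`. -/
def ιB : B →* G φA φB := Monoid.Coprod.inr.comp SemidirectProduct.inl

/-- The canonical homomorphism from the external free product `(A ∗ B) ∗ ℤ` to `G`,
sending `A` and `B` to their canonical copies and the generator of `ℤ` to `z = x₀y₀`. -/
def Ψ : Monoid.Coprod (Monoid.Coprod A B) (Multiplicative ℤ) →* G φA φB :=
  Monoid.Coprod.lift (Monoid.Coprod.lift (ιA φA φB) (ιB φA φB))
    (zpowersHom (G φA φB) (z φA φB))

theorem eq_one_or_eq_ofAdd_one (m : Multiplicative (ZMod 2)) :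
    m = 1 ∨ m = Multiplicative.ofAdd 1 := by
  revert m
  decide

theorem ofAdd_one_mul_self :
    (Multiplicative.ofAdd 1 * Multiplicative.ofAdd 1 : Multiplicative (ZMod 2)) = 1 := by
  decide

/-- The homomorphism from the group of order two determined by an element of square one. -/
def involutionHom {M : Type*} [Group M] (u : M) (hu : u * u = 1) :
    Multiplicative (ZMod 2) →* M :=
  MonoidHom.mk' (fun m => if m = 1 then 1 else u) (by
    have hne : (Multiplicative.ofAdd 1 : Multiplicative (ZMod 2)) ≠ 1 := by decide
    intro a b
    rcases eq_one_or_eq_ofAdd_one a with rfl | rfl <;>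
      rcases eq_one_or_eq_ofAdd_one b with rfl | rfl <;>
      simp [hne, ofAdd_one_mul_self, hu])

@[simp]
theorem involutionHom_ofAdd_one {M : Type*} [Group M] (u : M) (hu : u * u = 1) :
    involutionHom u hu (Multiplicative.ofAdd 1) = u :=
  if_neg (t := 1) (show (Multiplicative.ofAdd 1 : Multiplicative (ZMod 2)) ≠ 1 by decide)

theorem zmodTwoHom_ext {M : Type*} [Monoid M] {f g : Multiplicative (ZMod 2) →* M}
    (h : f (Multiplicative.ofAdd 1) = g (Multiplicative.ofAdd 1)) : f = g := by
  refine MonoidHom.ext fun m => ?_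
  rcases eq_one_or_eq_ofAdd_one m with rfl | rfl
  · simp
  · exact h

/-- The free product `A ∗ B ∗ ℤ`. -/
abbrev K (A B : Type*) [Group A] [Group B] :=
  Monoid.Coprod (Monoid.Coprod A B) (Multiplicative ℤ)

/-- The inclusion of `A` into `A ∗ B ∗ ℤ`. -/
def kA (A B : Type*) [Group A] [Group B] : A →* K A B := Monoid.Coprod.inl.comp Monoid.Coprod.inl

/-- The inclusion of `B` into `A ∗ B ∗ ℤ`. -/
def kB (A B : Type*) [Group A] [Group B] : B →* K A B := Monoid.Coprod.inl.comp Monoid.Coprod.inr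

/-- The generator of the factor `ℤ` of `A ∗ B ∗ ℤ`. -/
def kz (A B : Type*) [Group A] [Group B] : K A B := Monoid.Coprod.inr (Multiplicative.ofAdd 1)

theorem K.hom_ext {M : Type*} [Monoid M] {f g : K A B →* M}
    (hA : ∀ a, f (kA A B a) = g (kA A B a)) (hB : ∀ b, f (kB A B b) = g (kB A B b))
    (hz : f (kz A B) = g (kz A B)) : f = g := by
  refine Monoid.Coprod.hom_ext (Monoid.Coprod.hom_ext ?_ ?_) ?_
  · ext a; exact hA a
  · ext b; exact hB b
  · exact MonoidHom.ext_mint hz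

/-- The endomorphism of `A ∗ B ∗ ℤ` given by `δA` on `A`, by `b ↦ z (δB b) z⁻¹` on `B` and by
`z ↦ z⁻¹`. -/
def twist (δA : MulAut A) (δB : MulAut B) : K A B →* K A B :=
  Monoid.Coprod.lift
    (Monoid.Coprod.lift ((kA A B).comp δA.toMonoidHom)
      ((MulAut.conj (kz A B)).toMonoidHom.comp ((kB A B).comp δB.toMonoidHom)))
    (zpowersHom _ (kz A B)⁻¹)

section twist

variable (δA : MulAut A) (δB : MulAut B)

@[simp]
theorem twist_kA (a : A) : twist δA δB (kA A B a) = kA A B (δA a) := by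
  simp [twist, kA]

@[simp]
theorem twist_kB (b : B) :
    twist δA δB (kB A B b) = kz A B * kB A B (δB b) * (kz A B)⁻¹ := by
  simp [twist, kB]

@[simp]
theorem twist_kz : twist δA δB (kz A B) = (kz A B)⁻¹ := by
  simp [twist, kz]

theorem twist_comp_twist (hA : δA * δA = 1) (hB : δB * δB = 1) :
    (twist δA δB).comp (twist δA δB) = MonoidHom.id _ := by
  have hA' (a : A) : δA (δA a) = a := DFunLike.congr_fun hA a
  have hB' (b : B) : δB (δB b) = b := DFunLike.congr_fun hB b
  apply K.hom_ext
  · simp [hA']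
  · simp [hB', mul_assoc]
  · simp

/-- The action of `ℤ/2` on `A ∗ B ∗ ℤ` through `twist`. -/
def twistAction (hA : δA * δA = 1) (hB : δB * δB = 1) :
    Multiplicative (ZMod 2) →* MulAut (K A B) :=
  involutionHom
    (MonoidHom.toMulEquiv (twist δA δB) (twist δA δB) (twist_comp_twist δA δB hA hB)
      (twist_comp_twist δA δB hA hB))
    (MulEquiv.ext fun k => DFunLike.congr_fun (twist_comp_twist δA δB hA hB) k)

@[simp]
theorem twistAction_ofAdd_one (hA : δA * δA = 1) (hB : δB * δB = 1) (k : K A B) :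
    twistAction δA δB hA hB (Multiplicative.ofAdd 1) k = twist δA δB k := by
  simp [twistAction]

end twist

/-- A homomorphism out of `N ⋊ ℤ/2` determined by a homomorphism on `N` and an element of square
one inducing the action of the generator. -/
def liftInvolution {N M : Type*} [Group N] [Group M] {ψ : Multiplicative (ZMod 2) →* MulAut N}
    (f : N →* M) (u : M) (hu : u * u = 1)
    (h : ∀ n, f (ψ (Multiplicative.ofAdd 1) n) = u * f n * u⁻¹) :
    N ⋊[ψ] Multiplicative (ZMod 2) →* M :=
  SemidirectProduct.lift f (involutionHom u hu) (by
    intro m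
    ext n
    rcases eq_one_or_eq_ofAdd_one m with rfl | rfl
    · simp
    · simpa using h n)

section liftInvolution

variable {N M : Type*} [Group N] [Group M] {ψ : Multiplicative (ZMod 2) →* MulAut N}
    (f : N →* M) (u : M) (hu : u * u = 1)
    (h : ∀ n, f (ψ (Multiplicative.ofAdd 1) n) = u * f n * u⁻¹)

@[simp]
theorem liftInvolution_inl (n : N) : liftInvolution f u hu h (SemidirectProduct.inl n) = f n := by
  simp [liftInvolution]

@[simp]
theorem liftInvolution_inr :
    liftInvolution f u hu h (SemidirectProduct.inr (Multiplicative.ofAdd 1)) = u := by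
  simp [liftInvolution]

end liftInvolution

theorem inr_mul_inl_mul_inr_inv {N : Type*} [Group N] (ψ : Multiplicative (ZMod 2) →* MulAut N)
    (n : N) :
    (SemidirectProduct.inr (Multiplicative.ofAdd 1) * SemidirectProduct.inl n *
      (SemidirectProduct.inr (Multiplicative.ofAdd 1))⁻¹ : N ⋊[ψ] Multiplicative (ZMod 2)) =
      SemidirectProduct.inl (ψ (Multiplicative.ofAdd 1) n) := by
  rw [SemidirectProduct.inl_aut, map_inv]

theorem inr_mul_inr {N : Type*} [Group N] (ψ : Multiplicative (ZMod 2) →* MulAut N) :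
    (SemidirectProduct.inr (Multiplicative.ofAdd 1) *
      SemidirectProduct.inr (Multiplicative.ofAdd 1) : N ⋊[ψ] Multiplicative (ZMod 2)) = 1 := by
  rw [← map_mul, ofAdd_one_mul_self, map_one]

theorem x₀_mul_self : x₀ φA φB * x₀ φA φB = 1 := by
  rw [x₀, ← map_mul, inr_mul_inr, map_one]

theorem y₀_mul_self : y₀ φA φB * y₀ φA φB = 1 := by
  rw [y₀, ← map_mul, inr_mul_inr, map_one]

theorem x₀_inv : (x₀ φA φB)⁻¹ = x₀ φA φB := inv_eq_of_mul_eq_one_left (x₀_mul_self φA φB)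

theorem y₀_inv : (y₀ φA φB)⁻¹ = y₀ φA φB := inv_eq_of_mul_eq_one_left (y₀_mul_self φA φB)

theorem x₀_conj_ιA (a : A) :
    x₀ φA φB * ιA φA φB a * (x₀ φA φB)⁻¹ = ιA φA φB (φA (Multiplicative.ofAdd 1) a) := by
  simp only [x₀, ιA, MonoidHom.comp_apply, ← map_mul, ← map_inv]
  rw [map_inv, inr_mul_inl_mul_inr_inv]

theorem y₀_conj_ιB (b : B) :
    y₀ φA φB * ιB φA φB b * (y₀ φA φB)⁻¹ = ιB φA φB (φB (Multiplicative.ofAdd 1) b) := by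
  simp only [y₀, ιB, MonoidHom.comp_apply, ← map_mul, ← map_inv]
  rw [map_inv, inr_mul_inl_mul_inr_inv]

theorem x₀_conj_ιB (hB : φB (Multiplicative.ofAdd 1) * φB (Multiplicative.ofAdd 1) = 1) (b : B) :
    x₀ φA φB * ιB φA φB b * (x₀ φA φB)⁻¹ =
      z φA φB * ιB φA φB (φB (Multiplicative.ofAdd 1) b) * (z φA φB)⁻¹ := by
  have h := y₀_conj_ιB φA φB (φB (Multiplicative.ofAdd 1) b)
  rw [← MulAut.mul_apply, hB, MulAut.one_apply] at h
  rw [← h, z]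
  group

theorem x₀_conj_z : x₀ φA φB * z φA φB * (x₀ φA φB)⁻¹ = (z φA φB)⁻¹ := by
  rw [z, mul_inv_rev, ← mul_assoc, x₀_mul_self, one_mul, y₀_inv]

@[simp]
theorem Ψ_kA (a : A) : Ψ φA φB (kA A B a) = ιA φA φB a := by simp [Ψ, kA]

@[simp]
theorem Ψ_kB (b : B) : Ψ φA φB (kB A B b) = ιB φA φB b := by simp [Ψ, kB]

@[simp]
theorem Ψ_kz : Ψ φA φB (kz A B) = z φA φB := by simp [Ψ, kz]

theorem Ψ_twist (hB : φB (Multiplicative.ofAdd 1) * φB (Multiplicative.ofAdd 1) = 1) (k : K A B) :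
    Ψ φA φB (twist (φA (Multiplicative.ofAdd 1)) (φB (Multiplicative.ofAdd 1)) k) =
      x₀ φA φB * Ψ φA φB k * (x₀ φA φB)⁻¹ := by
  suffices h : (Ψ φA φB).comp
      (twist (φA (Multiplicative.ofAdd 1)) (φB (Multiplicative.ofAdd 1))) =
      (MulAut.conj (x₀ φA φB)).toMonoidHom.comp (Ψ φA φB) from DFunLike.congr_fun h k
  apply K.hom_ext
  · intro a
    simp [x₀_conj_ιA]
  · intro b
    simp [x₀_conj_ιB φA φB hB]
  · simp [x₀_conj_z]

section equivalence

variable (hA : φA (Multiplicative.ofAdd 1) * φA (Multiplicative.ofAdd 1) = 1)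
  (hB : φB (Multiplicative.ofAdd 1) * φB (Multiplicative.ofAdd 1) = 1)

/-- The homomorphism `(A ⋊ ℤ/2) ∗ (B ⋊ ℤ/2) → (A ∗ B ∗ ℤ) ⋊ ℤ/2`, sending `y₀` to `z⁻¹ x₀`. -/
def toSemidirect : G φA φB →* K A B ⋊[twistAction _ _ hA hB] Multiplicative (ZMod 2) :=
  Monoid.Coprod.lift
    (liftInvolution (SemidirectProduct.inl.comp (kA A B))
      (SemidirectProduct.inr (Multiplicative.ofAdd 1)) (inr_mul_inr _) (by
        intro a
        simp only [MonoidHom.comp_apply]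
        rw [inr_mul_inl_mul_inr_inv]
        simp))
    (liftInvolution (SemidirectProduct.inl.comp (kB A B))
      (SemidirectProduct.inl (kz A B)⁻¹ * SemidirectProduct.inr (Multiplicative.ofAdd 1))
      (by
        have h := inr_mul_inl_mul_inr_inv (twistAction _ _ hA hB) (kz A B)⁻¹
        rw [inv_eq_of_mul_eq_one_left (inr_mul_inr _)] at h
        rw [mul_assoc, ← mul_assoc (SemidirectProduct.inr _), h, ← map_mul]
        simp)
      (by
        intro b
        have h := inr_mul_inl_mul_inr_inv (twistAction _ _ hA hB) (kB A B b)
        simp only [MonoidHom.comp_apply]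
        rw [mul_inv_rev, mul_assoc, mul_assoc, ← mul_assoc (SemidirectProduct.inl (kB A B b)),
          ← mul_assoc (SemidirectProduct.inr _), ← mul_assoc (SemidirectProduct.inr _), h,
          ← map_inv, ← map_mul, ← map_mul]
        simp [mul_assoc]))

theorem toSemidirect_ιA (a : A) :
    toSemidirect φA φB hA hB (ιA φA φB a) = SemidirectProduct.inl (kA A B a) := by
  simp [toSemidirect, ιA]

theorem toSemidirect_ιB (b : B) :
    toSemidirect φA φB hA hB (ιB φA φB b) = SemidirectProduct.inl (kB A B b) := by
  simp [toSemidirect, ιB]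

theorem toSemidirect_x₀ :
    toSemidirect φA φB hA hB (x₀ φA φB) = SemidirectProduct.inr (Multiplicative.ofAdd 1) := by
  simp [toSemidirect, x₀]

theorem toSemidirect_y₀ :
    toSemidirect φA φB hA hB (y₀ φA φB) =
      SemidirectProduct.inl (kz A B)⁻¹ * SemidirectProduct.inr (Multiplicative.ofAdd 1) := by
  simp [toSemidirect, y₀]

theorem toSemidirect_Ψ (k : K A B) :
    toSemidirect φA φB hA hB (Ψ φA φB k) = SemidirectProduct.inl k := by
  suffices h : (toSemidirect φA φB hA hB).comp (Ψ φA φB) = SemidirectProduct.inl from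
    DFunLike.congr_fun h k
  apply K.hom_ext
  · simp [toSemidirect_ιA]
  · simp [toSemidirect_ιB]
  · have h := inr_mul_inl_mul_inr_inv (twistAction _ _ hA hB) (kz A B)⁻¹
    rw [inv_eq_of_mul_eq_one_left (inr_mul_inr _), mul_assoc] at h
    rw [MonoidHom.comp_apply, Ψ_kz, z, map_mul, toSemidirect_x₀, toSemidirect_y₀, h]
    simp

/-- The homomorphism `(A ∗ B ∗ ℤ) ⋊ ℤ/2 → (A ⋊ ℤ/2) ∗ (B ⋊ ℤ/2)` extending `Ψ`. -/
def ofSemidirect : K A B ⋊[twistAction _ _ hA hB] Multiplicative (ZMod 2) →* G φA φB :=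
  liftInvolution (Ψ φA φB) (x₀ φA φB) (x₀_mul_self φA φB) (by simp [Ψ_twist φA φB hB])

/-- Homomorphisms out of `G` agree when they agree on `A`, `B`, `x₀` and `y₀`. -/
theorem G.hom_ext {M : Type*} [Group M] {f g : G φA φB →* M}
    (hA : ∀ a, f (ιA φA φB a) = g (ιA φA φB a)) (hB : ∀ b, f (ιB φA φB b) = g (ιB φA φB b))
    (hx : f (x₀ φA φB) = g (x₀ φA φB)) (hy : f (y₀ φA φB) = g (y₀ φA φB)) : f = g := by
  refine Monoid.Coprod.hom_ext (SemidirectProduct.hom_ext ?_ ?_)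
    (SemidirectProduct.hom_ext ?_ ?_)
  · ext a; exact hA a
  · exact zmodTwoHom_ext hx
  · ext b; exact hB b
  · exact zmodTwoHom_ext hy

theorem ofSemidirect_toSemidirect (g : G φA φB) :
    ofSemidirect φA φB hA hB (toSemidirect φA φB hA hB g) = g := by
  suffices h : (ofSemidirect φA φB hA hB).comp (toSemidirect φA φB hA hB) = MonoidHom.id _ from
    DFunLike.congr_fun h g
  apply G.hom_ext
  · simp [toSemidirect_ιA, ofSemidirect]
  · simp [toSemidirect_ιB, ofSemidirect]
  · simp [toSemidirect_x₀, ofSemidirect]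
  · simp [toSemidirect_y₀, ofSemidirect, z, x₀_inv, y₀_inv, mul_assoc, x₀_mul_self]

theorem φ_ιA (a : A) : φ φA φB (ιA φA φB a) = 1 := by simp [φ, ιA]

theorem φ_ιB (b : B) : φ φA φB (ιB φA φB b) = 1 := by simp [φ, ιB]

theorem φ_x₀ : φ φA φB (x₀ φA φB) = Multiplicative.ofAdd 1 := by simp [φ, x₀]

theorem φ_y₀ : φ φA φB (y₀ φA φB) = Multiplicative.ofAdd 1 := by simp [φ, y₀]

theorem rightHom_toSemidirect (g : G φA φB) :
    (toSemidirect φA φB hA hB g).right = φ φA φB g := by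
  suffices h : SemidirectProduct.rightHom.comp (toSemidirect φA φB hA hB) = φ φA φB from
    DFunLike.congr_fun h g
  apply G.hom_ext
  · simp [toSemidirect_ιA, φ_ιA]
  · simp [toSemidirect_ιB, φ_ιB]
  · simp [toSemidirect_x₀, φ_x₀]
  · simp [toSemidirect_y₀, φ_y₀]

theorem Ψ_injective
    (hA : φA (Multiplicative.ofAdd 1) * φA (Multiplicative.ofAdd 1) = 1)
    (hB : φB (Multiplicative.ofAdd 1) * φB (Multiplicative.ofAdd 1) = 1) :
    Function.Injective (Ψ φA φB) := by
  intro k l h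
  have h' := congrArg (toSemidirect φA φB hA hB) h
  rw [toSemidirect_Ψ, toSemidirect_Ψ] at h'
  exact SemidirectProduct.inl_injective h'

theorem range_Ψ
    (hA : φA (Multiplicative.ofAdd 1) * φA (Multiplicative.ofAdd 1) = 1)
    (hB : φB (Multiplicative.ofAdd 1) * φB (Multiplicative.ofAdd 1) = 1) :
    (Ψ φA φB).range = (φ φA φB).ker := by
  ext g
  rw [MonoidHom.mem_ker]
  constructor
  · rintro ⟨k, rfl⟩
    rw [← rightHom_toSemidirect φA φB hA hB, toSemidirect_Ψ, SemidirectProduct.right_inl]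
  · intro hg
    refine ⟨(toSemidirect φA φB hA hB g).left, ?_⟩
    have h : toSemidirect φA φB hA hB g =
        SemidirectProduct.inl (toSemidirect φA φB hA hB g).left :=
      SemidirectProduct.ext rfl (by rw [rightHom_toSemidirect, hg, SemidirectProduct.right_inl])
    conv_rhs => rw [← ofSemidirect_toSemidirect φA φB hA hB g, h]
    simp [ofSemidirect]

end equivalence

/-- let `δ_A`, `δ_B` be involutive automorphisms of `A`, `B`, and form
`G := (A ⋊ ⟨x₀⟩) ∗ (B ⋊ ⟨y₀⟩)` where the order-2 groups act via `δ_A`, `δ_B`.  Let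
`φ : G → ℤ/2` kill `A, B` and send `x₀, y₀` to the generator, and `H := ker φ`.  Then:
(a) `H` is the internal free product of the subgroups `A`, `B` and `⟨z⟩` with `z = x₀y₀`,
i.e. the canonical map `Ψ : A ∗ B ∗ ℤ → G` is injective with range `H`, so `H ≅ A ∗ B ∗ ℤ`;
(b) `G = H ⋊ ⟨x₀⟩` (with `x₀² = 1`, `x₀ ∉ H`, `H ⊓ ⟨x₀⟩ = ⊥`, `H ⊔ ⟨x₀⟩ = ⊤`);
(c) conjugation by `x₀` acts by `δ_A` on `A`, by `b ↦ z δ_B(b) z⁻¹` on `B`, and sends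
`z` to `z⁻¹`.  Consequently `(A ⋊ ℤ/2) ∗ (B ⋊ ℤ/2) ≅ (A ∗ B ∗ ℤ) ⋊ ℤ/2` with this action. -/
theorem stmt_0 (δA : MulAut A) (δB : MulAut B) (hA2 : δA * δA = 1) (hB2 : δB * δB = 1)
    (hφA : φA (Multiplicative.ofAdd 1) = δA) (hφB : φB (Multiplicative.ofAdd 1) = δB) :
    -- (a)
    (Function.Injective (Ψ φA φB) ∧ (Ψ φA φB).range = (φ φA φB).ker) ∧
    -- (b)
    ((x₀ φA φB) ^ 2 = 1 ∧ x₀ φA φB ∉ (φ φA φB).ker ∧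
      (φ φA φB).ker ⊓ Subgroup.zpowers (x₀ φA φB) = ⊥ ∧
      (φ φA φB).ker ⊔ Subgroup.zpowers (x₀ φA φB) = ⊤) ∧
    -- (c)
    ((∀ a : A, x₀ φA φB * ιA φA φB a * (x₀ φA φB)⁻¹ = ιA φA φB (δA a)) ∧
      (∀ b : B, x₀ φA φB * ιB φA φB b * (x₀ φA φB)⁻¹ =
        z φA φB * ιB φA φB (δB b) * (z φA φB)⁻¹) ∧
      x₀ φA φB * z φA φB * (x₀ φA φB)⁻¹ = (z φA φB)⁻¹) := by
  subst hφA hφB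
  have hx : x₀ φA φB ∉ (φ φA φB).ker := by
    rw [MonoidHom.mem_ker, φ_x₀]
    decide
  refine ⟨⟨Ψ_injective φA φB hA2 hB2, range_Ψ φA φB hA2 hB2⟩,
    ⟨by rw [pow_two, x₀_mul_self], hx, ?_, ?_⟩,
    x₀_conj_ιA φA φB, x₀_conj_ιB φA φB hB2, x₀_conj_z φA φB⟩
  · rw [eq_bot_iff]
    rintro g ⟨hg, n, rfl⟩
    have hpow (m : ℤ) : x₀ φA φB ^ (2 * m) = 1 := by
      rw [zpow_mul, zpow_ofNat, pow_two, x₀_mul_self, one_zpow]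
    rcases Int.even_or_odd' n with ⟨m, rfl | rfl⟩
    · exact hpow m
    · refine absurd ?_ hx
      have hg' : x₀ φA φB ^ (2 * m + 1) ∈ (φ φA φB).ker := hg
      rwa [zpow_add_one, hpow, one_mul] at hg'
  · rw [eq_top_iff]
    intro g _
    rcases eq_one_or_eq_ofAdd_one (φ φA φB g) with h | h
    · exact Subgroup.mem_sup_left h
    · rw [← mul_inv_cancel_right g (x₀ φA φB)]
      refine Subgroup.mul_mem_sup ?_ (inv_mem (Subgroup.mem_zpowers _))
      rw [MonoidHom.mem_ker, map_mul, h, φ_x₀, ofAdd_one_mul_self]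

end Stmt0
end

section
/- Let Γ be a finite simple graph with vertex set {1,…,d}, let A(Γ) be the right-angled Artin group presented by generators x₁,…,x_d and relations [x_u,x_v] = 1 for each edge {u,v} of Γ, and let z = (z₁,…,z_d) be a d-tuple of elements of A(Γ) for which there exists an automorphism δ_z of A(Γ) with δ_z(x_i) = z_i⁻¹·x_i⁻¹·z_i for all i and δ_z∘δ_z = id. Let G_z := A(Γ) ⋊_{δ_z} Δ, where Δ = ⟨x₀⟩ is cyclic of order 2 acting through δ_z. Then the commutator subgroup [G_z, G_z] equals the subgroup of G_z generated by all squares {g² : g ∈ G_z}, and both equal the subgroup of A(Γ) generated by all squares {a² : a ∈ A(Γ)}. -/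
def raagRels {d : ℕ} (Γ : SimpleGraph (Fin d)) : Set (FreeGroup (Fin d)) :=
  {r | ∃ u v : Fin d, Γ.Adj u v ∧
    r = (FreeGroup.of u)⁻¹ * (FreeGroup.of v)⁻¹ * FreeGroup.of u * FreeGroup.of v}

/-- The right-angled Artin group on the graph `Γ`, presented by one generator for
each vertex and commutation relations for edges. -/
abbrev RAAG {d : ℕ} (Γ : SimpleGraph (Fin d)) : Type := PresentedGroup (raagRels Γ)

/-- The generator of `RAAG Γ` corresponding to the vertex `i`. -/
def raagGen {d : ℕ} (Γ : SimpleGraph (Fin d)) (i : Fin d) : RAAG Γ :=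
  PresentedGroup.of (rels := raagRels Γ) i

/-- The subgroup generated by all squares is normal. -/
theorem normal_closure_squares (A : Type*) [Group A] :
    (Subgroup.closure {y : A | ∃ a, y = a ^ 2}).Normal := by
  have h : Subgroup.normalClosure {y : A | ∃ a, y = a ^ 2} =
      Subgroup.closure {y : A | ∃ a, y = a ^ 2} := by
    refine le_antisymm ?_ Subgroup.closure_le_normalClosure
    refine (Subgroup.closure_le _).mpr fun y hy => Subgroup.subset_closure ?_
    obtain ⟨_, ⟨a, rfl⟩, hc⟩ := Group.mem_conjugatesOfSet_iff.mp hy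
    obtain ⟨c, rfl⟩ := isConj_iff.mp hc
    exact ⟨c * a * c⁻¹, conj_pow.symm⟩
  rw [← h]
  exact Subgroup.normalClosure_normal

/-- A `δ`-invariant homomorphism to an abelian group sends every element to one of order
dividing two. -/
theorem RAAG.map_sq_eq_one {d : ℕ} {Γ : SimpleGraph (Fin d)} {z : Fin d → RAAG Γ}
    {δ : MulAut (RAAG Γ)}
    (hδ : ∀ i : Fin d, δ (raagGen Γ i) = (z i)⁻¹ * (raagGen Γ i)⁻¹ * z i)
    {H : Type*} [CommGroup H] (f : RAAG Γ →* H) (hf : ∀ a, f (δ a) = f a) (a : RAAG Γ) :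
    f a ^ 2 = 1 := by
  have h : (powMonoidHom 2).comp f = 1 := PresentedGroup.ext fun i => by
    have hi := hf (raagGen Γ i)
    rw [hδ, map_mul, map_mul, map_inv, map_inv, mul_right_comm, inv_mul_cancel, one_mul] at hi
    change f (raagGen Γ i) ^ 2 = 1
    rw [pow_two]
    nth_rewrite 1 [← hi]
    exact inv_mul_cancel _
  exact DFunLike.congr_fun h a

/-- A homomorphism to an abelian group of exponent two is invariant under `δ`. -/
theorem RAAG.map_apply_eq_of_sq_eq_one {d : ℕ} {Γ : SimpleGraph (Fin d)} {z : Fin d → RAAG Γ}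
    {δ : MulAut (RAAG Γ)}
    (hδ : ∀ i : Fin d, δ (raagGen Γ i) = (z i)⁻¹ * (raagGen Γ i)⁻¹ * z i)
    {H : Type*} [CommGroup H] (hH : ∀ x : H, x ^ 2 = 1) (f : RAAG Γ →* H) (a : RAAG Γ) :
    f (δ a) = f a := by
  have h : f.comp δ.toMonoidHom = f := PresentedGroup.ext fun i => by
    change f (δ (raagGen Γ i)) = f (raagGen Γ i)
    rw [hδ, map_mul, map_mul, map_inv, map_inv, mul_right_comm, inv_mul_cancel, one_mul,
      inv_eq_iff_mul_eq_one, ← pow_two, hH]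
  exact DFunLike.congr_fun h a


/-- for a Δ-RAAG `G_z = A(Γ) ⋊[φ] Δ` (where `Δ = ℤ/2` acts through an
automorphism `δ` with `δ(xᵢ) = zᵢ⁻¹ xᵢ⁻¹ zᵢ` and `δ ∘ δ = id`), the commutator subgroup
of `G_z` equals the subgroup generated by all squares of `G_z`, and both equal the
subgroup of `A(Γ)` generated by all squares of `A(Γ)` (viewed inside `G_z`). -/
theorem stmt_3 {d : ℕ} (Γ : SimpleGraph (Fin d)) (z : Fin d → RAAG Γ)
    (δ : MulAut (RAAG Γ)) (hδ2 : δ * δ = 1)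
    (hδ : ∀ i : Fin d, δ (raagGen Γ i) = (z i)⁻¹ * (raagGen Γ i)⁻¹ * z i)
    (φ : Multiplicative (ZMod 2) →* MulAut (RAAG Γ))
    (hφ : φ (Multiplicative.ofAdd 1) = δ) :
    commutator (RAAG Γ ⋊[φ] Multiplicative (ZMod 2)) =
      Subgroup.closure {y : RAAG Γ ⋊[φ] Multiplicative (ZMod 2) | ∃ g, y = g ^ 2} ∧
    commutator (RAAG Γ ⋊[φ] Multiplicative (ZMod 2)) =
      Subgroup.map SemidirectProduct.inl
        (Subgroup.closure {y : RAAG Γ | ∃ a, y = a ^ 2}) := by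
  have hΔ : ∀ t : Multiplicative (ZMod 2), t = 1 ∨ t = Multiplicative.ofAdd 1 := by decide
  have hΔ2 : ∀ t : Multiplicative (ZMod 2), t ^ 2 = 1 := by decide
  set P := Subgroup.closure {y : RAAG Γ | ∃ a, y = a ^ 2} with hP
  have hPS : P.map SemidirectProduct.inl ≤
      Subgroup.closure {y : RAAG Γ ⋊[φ] Multiplicative (ZMod 2) | ∃ g, y = g ^ 2} := by
    rw [Subgroup.map_le_iff_le_comap, hP, Subgroup.closure_le]
    rintro _ ⟨a, rfl⟩
    exact Subgroup.subset_closure ⟨SemidirectProduct.inl a, map_pow _ _ _⟩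
  have hSC : Subgroup.closure {y : RAAG Γ ⋊[φ] Multiplicative (ZMod 2) | ∃ g, y = g ^ 2} ≤
      commutator (RAAG Γ ⋊[φ] Multiplicative (ZMod 2)) := by
    rw [Subgroup.closure_le]
    rintro _ ⟨g, rfl⟩
    rw [SetLike.mem_coe, ← Abelianization.ker_of, MonoidHom.mem_ker, map_pow,
      ← SemidirectProduct.inl_left_mul_inr_right g, map_mul, mul_pow,
      ← map_pow _ (SemidirectProduct.inr _), ← map_pow SemidirectProduct.inr, hΔ2, map_one,
      map_one, mul_one]
    refine RAAG.map_sq_eq_one hδ (Abelianization.of.comp SemidirectProduct.inl) (fun a => ?_)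
      g.left
    rw [← hφ, MonoidHom.comp_apply, SemidirectProduct.inl_aut, map_mul, map_mul, mul_right_comm,
      ← map_mul, ← map_mul SemidirectProduct.inr, mul_inv_cancel, map_one, map_one, one_mul, MonoidHom.comp_apply]
  have hCP : commutator (RAAG Γ ⋊[φ] Multiplicative (ZMod 2)) ≤
      P.map SemidirectProduct.inl := by
    have : P.Normal := normal_closure_squares _
    have hV : ∀ x : RAAG Γ ⧸ P, x ^ 2 = 1 := fun x => by
      obtain ⟨a, rfl⟩ := QuotientGroup.mk_surjective x
      rw [← QuotientGroup.mk_pow, QuotientGroup.eq_one_iff]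
      exact Subgroup.subset_closure ⟨a, rfl⟩
    let _ : CommGroup (RAAG Γ ⧸ P) :=
      { (inferInstance : Group (RAAG Γ ⧸ P)) with
        mul_comm := fun x y => by
          have hinv : ∀ w : RAAG Γ ⧸ P, w⁻¹ = w := fun w =>
            inv_eq_of_mul_eq_one_right (by rw [← pow_two, hV])
          rw [← hinv (x * y), mul_inv_rev, hinv, hinv] }
    let F : RAAG Γ ⋊[φ] Multiplicative (ZMod 2) →* RAAG Γ ⧸ P :=
      SemidirectProduct.lift (QuotientGroup.mk' P) 1 fun t => by
        refine MonoidHom.ext fun a => ?_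
        rcases hΔ t with rfl | rfl
        · simp
        · simpa [hφ] using RAAG.map_apply_eq_of_sq_eq_one hδ hV (QuotientGroup.mk' P) a
    intro g hg
    have hF : F g = 1 := Abelianization.commutator_subset_ker F hg
    have hr : g.right = 1 :=
      Abelianization.commutator_subset_ker SemidirectProduct.rightHom hg
    have hg' : SemidirectProduct.inl g.left = g := by
      conv_rhs => rw [← SemidirectProduct.inl_left_mul_inr_right g, hr, map_one, mul_one]
    refine ⟨g.left, ?_, hg'⟩
    rw [← hg', SemidirectProduct.lift_inl] at hF
    exact (QuotientGroup.eq_one_iff _).mp hF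
  exact ⟨le_antisymm (hCP.trans hPS) hSC, le_antisymm hCP (hPS.trans hSC)⟩
end

section
/- Let Γ₁ and Γ₂ be finite simple graphs with d₁ and d₂ vertices respectively, let A(Γ₁) and A(Γ₂) be the right-angled Artin groups presented by generators x₁,…,x_{d} and relations [x_u,x_v] = 1 for each edge {u,v}, and let z₁ ∈ A(Γ₁)^{d₁}, z₂ ∈ A(Γ₂)^{d₂} be tuples for which there exist automorphisms δ_{z₁}, δ_{z₂} of A(Γ₁), A(Γ₂) squaring to the identity and sending each generator x_i to z_i⁻¹·x_i⁻¹·z_i. If the two Δ-RAAGs G_{z₁} := A(Γ₁) ⋊_{δ_{z₁}} Δ and G_{z₂} := A(Γ₂) ⋊_{δ_{z₂}} Δ (with Δ cyclic of order 2) are isomorphic as groups, then the graphs Γ₁ and Γ₂ are isomorphic. -/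
section Graph

variable {V K : Type*} [Field K]

/-- Two functions on the vertices of `Γ` are proportional along every edge. For the classes in
`H¹` of the right-angled Artin group with these values on generators, this says that their
cup product vanishes. -/
def EdgeProportional (Γ : SimpleGraph V) (f g : V → K) : Prop :=
  ∀ i j, Γ.Adj i j → f i * g j = f j * g i

variable [Fintype V] [DecidableEq V]

lemma Matrix.exists_perm_of_det_ne_zero {κ : Type*} [Fintype κ] [DecidableEq κ]
    {M : Matrix V V K} (hM : M.det ≠ 0) (cl : V → κ) :
    ∃ σ : Equiv.Perm V, (∀ i, M (σ i) i ≠ 0) ∧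
      ∀ i j, i ≠ j → cl (σ i) = cl (σ j) →
        ∃ a b, cl a = cl (σ i) ∧ cl b = cl (σ i) ∧ M a i * M b j ≠ M b i * M a j := by
  let N : (V → κ) → Matrix V V K := fun τ => Matrix.of fun s i => if cl s = τ i then M s i else 0
  have hsum : M.det = ∑ τ : V → κ, (N τ).det := by
    have h := (Matrix.detRowAlternating (n := V) (R := K)).toMultilinearMap.map_sum
      (fun (i : V) (k : κ) (s : V) => if cl s = k then M s i else 0)
    have hM' : (fun i => ∑ k : κ, fun s : V => if cl s = k then M s i else 0) = M.transpose := by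
      ext i s
      simp [Finset.sum_apply]
    rw [hM'] at h
    rw [← Matrix.det_transpose]
    refine h.trans (Finset.sum_congr rfl fun τ _ => ?_)
    rw [← Matrix.det_transpose]
    rfl
  obtain ⟨τ, -, hτ⟩ := Finset.exists_ne_zero_of_sum_ne_zero (hsum ▸ hM)
  have hdet := hτ
  rw [Matrix.det_apply] at hτ
  obtain ⟨σ, -, hσ⟩ := Finset.exists_ne_zero_of_sum_ne_zero hτ
  have hσ' : ∀ i, N τ (σ i) i ≠ 0 := by
    intro i hi
    have h0 : ∏ k, N τ (σ k) k = 0 := Finset.prod_eq_zero (Finset.mem_univ i) hi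
    exact hσ (by rw [h0, smul_zero])
  have hcl : ∀ i, cl (σ i) = τ i := by
    intro i
    by_contra h
    exact hσ' i (by simp [N, h])
  refine ⟨σ, fun i hi => hσ' i (by simp [N, hi]), fun i j hij hc => ?_⟩
  by_contra! hcon
  rw [hcl, hcl] at hc
  rw [hcl] at hcon
  refine hdet (Matrix.exists_mulVec_eq_zero_iff.mp
    ⟨Pi.single i (N τ (σ i) j) - Pi.single j (N τ (σ i) i), fun h => ?_, ?_⟩)
  · have := congrFun h j
    simp [hij.symm, hσ'] at this
  · ext a
    simp only [Matrix.mulVec_sub, Matrix.mulVec_single, Pi.sub_apply, Pi.smul_apply,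
      Matrix.col_apply, MulOpposite.smul_eq_mul_unop, MulOpposite.unop_op, Pi.zero_apply]
    by_cases ha : cl a = τ i
    · have := hcon a (σ i) ha (hcl i)
      simp [N, ha, hcl, ← hc]
      linear_combination this
    · simp [N, ha, ← hc]

variable (Γ₁ Γ₂ : SimpleGraph V)

lemma card_not_adj_le_of_edgeProportional (T : (V → K) ≃ₗ[K] (V → K))
    (hT : ∀ f g, EdgeProportional Γ₁ f g → EdgeProportional Γ₂ (T f) (T g))
    {i s : V} (hs : T (Pi.single i 1) s ≠ 0) :
    Nat.card {j // ¬ Γ₁.Adj i j} ≤ Nat.card {j // ¬ Γ₂.Adj s j} ∧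
    (Nat.card {j // ¬ Γ₁.Adj i j} = Nat.card {j // ¬ Γ₂.Adj s j} →
      ∀ x t, x ≠ s → ¬ Γ₂.Adj s x → T (Pi.single i 1) t ≠ 0 → ¬ Γ₂.Adj t x) := by
  classical
  let E := Function.ExtendByZero.linearMap K (Subtype.val : {j // ¬ Γ₁.Adj i j} → V)
  let L : ({j // ¬ Γ₁.Adj i j} → K) →ₗ[K] ({j // ¬ Γ₂.Adj s j} → K) :=
    (LinearMap.funLeft K K Subtype.val).comp (T.toLinearMap.comp E)
  have hE : ∀ w, EdgeProportional Γ₁ (Pi.single i 1) (E w) := by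
    have key : ∀ w a b, Γ₁.Adj a b → (Pi.single i 1 : V → K) a * E w b = 0 := by
      intro w a b hab
      rcases eq_or_ne a i with rfl | ha
      · have : E w b = 0 := by
          simp only [E, Function.ExtendByZero.linearMap_apply]
          rw [Function.extend_apply']
          · rfl
          · rintro ⟨⟨y, hy⟩, rfl⟩
            exact hy hab
        rw [this, mul_zero]
      · simp [ha]
    intro w a b hab
    rw [key w a b hab, key w b a hab.symm]
  have hTE : ∀ w j, Γ₂.Adj s j → L w = 0 → T (E w) j = 0 := by
    intro w j hj hw
    have h1 := hT _ _ (hE w) s j hj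
    have h2 : T (E w) s = 0 := congrFun hw ⟨s, Γ₂.loopless.irrefl s⟩
    rw [h2, mul_zero] at h1
    exact (mul_eq_zero.mp h1).resolve_left hs
  have hL : Function.Injective L := by
    rw [injective_iff_map_eq_zero]
    intro w hw
    have h0 : T (E w) = 0 := by
      ext j
      by_cases hj : Γ₂.Adj s j
      · exact hTE w j hj hw
      · exact congrFun hw ⟨j, hj⟩
    rw [LinearEquiv.map_eq_zero_iff] at h0
    ext ⟨j, hj⟩
    have := congrFun h0 j
    simp only [E, Function.ExtendByZero.linearMap_apply] at this
    rwa [Function.Injective.extend_apply Subtype.val_injective _ _ (⟨j, hj⟩ : {j // ¬ Γ₁.Adj i j})]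
      at this
  refine ⟨?_, fun hcard x t hxs hx ht hadj => ?_⟩
  · simpa [Nat.card_eq_fintype_card] using LinearMap.finrank_le_finrank_of_injective hL
  · have hsurj : Function.Surjective L := by
      refine (LinearMap.injective_iff_surjective_of_finrank_eq_finrank ?_).mp hL
      simpa [Nat.card_eq_fintype_card] using hcard
    obtain ⟨w, hw⟩ := hsurj (Pi.single ⟨x, hx⟩ 1)
    have hv : ∀ j, j ≠ x → T (E w) j = 0 := by
      have hns : ∀ j, ¬ Γ₂.Adj s j → j ≠ x → T (E w) j = 0 := by
        intro j hj hjx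
        have := congrFun hw ⟨j, hj⟩
        rw [Pi.single_eq_of_ne (by simpa using hjx)] at this
        exact this
      intro j hjx
      by_cases hj : Γ₂.Adj s j
      · have h1 := hT _ _ (hE w) s j hj
        rw [hns s (Γ₂.loopless.irrefl s) hxs.symm, mul_zero] at h1
        exact (mul_eq_zero.mp h1).resolve_left hs
      · exact hns j hj hjx
    have hvx : T (E w) x = 1 := by
      have := congrFun hw ⟨x, hx⟩
      rw [Pi.single_eq_same] at this
      exact this
    have h1 := hT _ _ (hE w) t x hadj
    rw [hvx, hv t hadj.ne, mul_zero, mul_one] at h1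
    exact ht h1

/-- A graph is determined by the relation of being proportional along its edges. -/
theorem nonempty_iso_of_edgeProportional (T : (V → K) ≃ₗ[K] (V → K))
    (hT : ∀ f g, EdgeProportional Γ₁ f g ↔ EdgeProportional Γ₂ (T f) (T g)) :
    Nonempty (Γ₁ ≃g Γ₂) := by
  classical
  have exists_perm : ∀ (Γ' : SimpleGraph V) (T : (V → K) ≃ₗ[K] (V → K)),
      ∃ σ : Equiv.Perm V, (∀ i, T (Pi.single i 1) (σ i) ≠ 0) ∧
      ∀ i j, i ≠ j → (∀ x, (x = σ i ∨ Γ'.Adj (σ i) x) ↔ (x = σ j ∨ Γ'.Adj (σ j) x)) →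
        ¬ EdgeProportional Γ' (T (Pi.single i 1)) (T (Pi.single j 1)) := by
    intro Γ' T
    obtain ⟨σ, h1, h2⟩ := Matrix.exists_perm_of_det_ne_zero
      (M := LinearMap.toMatrix' T.toLinearMap)
      (by
        rw [LinearMap.det_toMatrix']
        exact (LinearEquiv.isUnit_det' T).ne_zero)
      (fun s => (Finset.univ.filter fun x => x = s ∨ Γ'.Adj s x))
    refine ⟨σ, fun i => by simpa [LinearMap.toMatrix'_apply] using h1 i, ?_⟩
    intro i j hij htwin hprop
    obtain ⟨a, b, ha, hb, hne⟩ := h2 i j hij (by simpa [Finset.ext_iff] using htwin)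
    simp only [LinearMap.toMatrix'_apply, LinearEquiv.coe_coe] at hne
    rcases eq_or_ne a b with rfl | hab
    · exact hne rfl
    · have := (Finset.ext_iff.mp (ha.trans hb.symm)) b
      simp only [Finset.mem_filter, Finset.mem_univ, true_and, true_or, iff_true] at this
      exact hne (hprop a b (this.resolve_left hab.symm))
  obtain ⟨σ, hσ, hσ'⟩ := exists_perm Γ₂ T
  have hTs : ∀ f g, EdgeProportional Γ₂ f g → EdgeProportional Γ₁ (T.symm f) (T.symm g) := by
    intro f g h
    rw [hT]
    simpa using h
  obtain ⟨ρ, hρ, -⟩ := exists_perm Γ₁ T.symm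
  have hle : ∀ i ∈ Finset.univ,
      Nat.card {j // ¬ Γ₁.Adj i j} ≤ Nat.card {j // ¬ Γ₂.Adj (σ i) j} := fun i _ =>
    (card_not_adj_le_of_edgeProportional Γ₁ Γ₂ T (fun f g => (hT f g).mp) (hσ i)).1
  have hge : ∑ i, Nat.card {j // ¬ Γ₂.Adj (σ i) j} ≤ ∑ i, Nat.card {j // ¬ Γ₁.Adj i j} := by
    rw [Equiv.sum_comp σ fun s => Nat.card {j // ¬ Γ₂.Adj s j},
      ← Equiv.sum_comp ρ fun s => Nat.card {j // ¬ Γ₁.Adj s j}]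
    exact Finset.sum_le_sum fun i _ =>
      (card_not_adj_le_of_edgeProportional Γ₂ Γ₁ T.symm hTs (hρ i)).1
  have hcard : ∀ i, Nat.card {j // ¬ Γ₁.Adj i j} = Nat.card {j // ¬ Γ₂.Adj (σ i) j} := fun i =>
    (Finset.sum_eq_sum_iff_of_le hle).mp (le_antisymm (Finset.sum_le_sum hle) hge) i
      (Finset.mem_univ i)
  have hdom := fun i => (card_not_adj_le_of_edgeProportional Γ₁ Γ₂ T
    (fun f g => (hT f g).mp) (hσ i)).2 (hcard i)
  have hnon : ∀ i j, ¬ Γ₁.Adj i j → ¬ Γ₂.Adj (σ i) (σ j) := by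
    intro i j hij hadj
    have hne : i ≠ j := by
      rintro rfl
      exact Γ₂.loopless.irrefl _ hadj
    have hprop : EdgeProportional Γ₁ (Pi.single i 1 : V → K) (Pi.single j 1) := by
      have key : ∀ a b, Γ₁.Adj a b →
          (Pi.single i 1 : V → K) a * (Pi.single j 1 : V → K) b = 0 := by
        intro a b hab
        rcases eq_or_ne a i with rfl | ha
        · rcases eq_or_ne b j with rfl | hb
          · exact absurd hab hij
          · simp [hb]
        · simp [ha]
      intro a b hab
      rw [key a b hab, key b a hab.symm]
    have hprop' := (hT _ _).mp hprop
    have h := hprop' _ _ hadj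
    have hprod := h ▸ mul_ne_zero (hσ i) (hσ j)
    have hi := fun x => hdom i x (σ j)
    have hj := fun x => hdom j x (σ i)
    refine hσ' i j hne (fun x => ?_) hprop'
    have h1 := left_ne_zero_of_mul hprod
    have h2 := right_ne_zero_of_mul hprod
    have hadj' := hadj.symm
    constructor
    · rintro (rfl | hx)
      · exact Or.inr hadj'
      · by_contra! hx'
        exact hj x hx'.1 hx'.2 h2 hx
    · rintro (rfl | hx)
      · exact Or.inr hadj
      · by_contra! hx'
        exact hi x hx'.1 hx'.2 h1 hx
  refine ⟨⟨σ, fun {i j} => ?_⟩⟩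
  let F : {j // ¬ Γ₁.Adj i j} → {j // ¬ Γ₂.Adj (σ i) j} := fun j => ⟨σ j, hnon i j j.2⟩
  have hF : Function.Bijective F := by
    refine (Nat.bijective_iff_injective_and_card F).mpr ⟨fun a b hab => ?_, hcard i⟩
    exact Subtype.ext (σ.injective (congrArg Subtype.val hab))
  refine ⟨fun h => by_contra fun h' => hnon i j h' h, fun h => by_contra fun h' => ?_⟩
  obtain ⟨y, hy⟩ := hF.2 ⟨σ j, h'⟩
  exact y.2 (σ.injective (congrArg Subtype.val hy) ▸ h)

end Graph

section Raag

variable {d : ℕ} {Γ : SimpleGraph (Fin d)}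

/-- The homomorphism out of a right-angled Artin group given by elements that commute along
edges. -/
def raagLift {H : Type*} [Group H] (f : Fin d → H)
    (hf : ∀ i j, Γ.Adj i j → Commute (f i) (f j)) : RAAG Γ →* H :=
  PresentedGroup.toGroup (f := f) (by
    rintro _ ⟨u, v, huv, rfl⟩
    simp only [map_mul, map_inv, FreeGroup.lift_apply_of]
    rw [← mul_inv_rev, mul_assoc, ← (hf u v huv).eq, (hf u v huv).eq, inv_mul_eq_one])

@[simp]
lemma raagLift_gen {H : Type*} [Group H] (f : Fin d → H)
    (hf : ∀ i j, Γ.Adj i j → Commute (f i) (f j)) (i : Fin d) :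
    raagLift f hf (raagGen Γ i) = f i :=
  PresentedGroup.toGroup.of _

lemma raag_hom_ext {H : Type*} [Monoid H] {F F' : RAAG Γ →* H}
    (h : ∀ i, F (raagGen Γ i) = F' (raagGen Γ i)) : F = F' :=
  MonoidHom.eq_of_eqOn_dense (PresentedGroup.closure_range_of _) (by rintro _ ⟨i, rfl⟩; exact h i)

/-- `c` is a crossed homomorphism for the action of `G` through the character `χ`. -/
def IsCrossedHom {G : Type*} [Group G] (χ : G →* ℚ) (c : G → ℚ) : Prop :=
  ∀ g h, c (g * h) = c g + χ g * c h

lemma IsCrossedHom.map_one {G : Type*} [Group G] {χ : G →* ℚ} {c : G → ℚ}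
    (hc : IsCrossedHom χ c) : c 1 = 0 := by
  have := hc 1 1
  simpa using this

lemma IsCrossedHom.eq_zero_of_raagGen {χ : RAAG Γ →* ℚ} {c : RAAG Γ → ℚ} (hc : IsCrossedHom χ c)
    (h : ∀ i, c (raagGen Γ i) = 0) (a : RAAG Γ) : c a = 0 := by
  have ha : a ∈ Subgroup.closure (Set.range (PresentedGroup.of (rels := raagRels Γ))) := by
    rw [PresentedGroup.closure_range_of]
    trivial
  induction ha using Subgroup.closure_induction with
  | mem x hx =>
    obtain ⟨i, rfl⟩ := hx
    exact h i
  | one => exact hc.map_one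
  | mul x y _ _ hx hy => rw [hc, hx, hy, mul_zero, add_zero]
  | inv x _ hx =>
    have := hc x⁻¹ x
    rw [inv_mul_cancel, hc.map_one, hx, mul_zero, add_zero] at this
    exact this.symm

variable (Γ) in
/-- The homomorphism from a right-angled Artin group to `ℚ` with prescribed values on
generators. -/
def raagChar (f : Fin d → ℚ) : RAAG Γ →* Multiplicative ℚ :=
  raagLift (fun i => Multiplicative.ofAdd (f i)) fun _ _ _ => Commute.all _ _

variable (Γ) in
/-- `raagChar` as a linear map into the functions on the group. -/
def raagCharLinear : (Fin d → ℚ) →ₗ[ℚ] (RAAG Γ → ℚ) where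
  toFun f a := (raagChar Γ f a).toAdd
  map_add' f g := by
    have : raagChar Γ (f + g) = raagChar Γ f * raagChar Γ g :=
      raag_hom_ext fun i => by simp [raagChar]
    ext a
    simp [this]
  map_smul' r f := by
    have : raagChar Γ (r • f) =
        (AddMonoidHom.toMultiplicative (AddMonoidHom.mulLeft r)).comp (raagChar Γ f) :=
      raag_hom_ext fun i => by simp [raagChar]
    ext a
    simp [this]

lemma raagCharLinear_apply (f : Fin d → ℚ) (a : RAAG Γ) :
    raagCharLinear Γ f a = (raagChar Γ f a).toAdd := rfl

@[simp]
lemma raagCharLinear_gen (f : Fin d → ℚ) (i : Fin d) : raagCharLinear Γ f (raagGen Γ i) = f i := by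
  simp [raagCharLinear_apply, raagChar]

lemma raagCharLinear_mul (f : Fin d → ℚ) (a b : RAAG Γ) :
    raagCharLinear Γ f (a * b) = raagCharLinear Γ f a + raagCharLinear Γ f b := by
  simp [raagCharLinear_apply]

lemma raagCharLinear_comp_hom {d' : ℕ} {Γ' : SimpleGraph (Fin d')} (ψ : RAAG Γ →* RAAG Γ')
    (f : Fin d' → ℚ) (a : RAAG Γ) :
    raagCharLinear Γ (fun i => raagCharLinear Γ' f (ψ (raagGen Γ i))) a =
      raagCharLinear Γ' f (ψ a) := by
  have : raagChar Γ (fun i => raagCharLinear Γ' f (ψ (raagGen Γ i))) = (raagChar Γ' f).comp ψ :=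
    raag_hom_ext fun i => by simp [raagChar, raagCharLinear_apply]
  rw [raagCharLinear_apply, this]
  rfl

/-- The Heisenberg group over `ℚ`. -/
@[ext]
structure RatHeisenberg where
  /-- the first abelian coordinate -/
  x : ℚ
  /-- the second abelian coordinate -/
  y : ℚ
  /-- the central coordinate -/
  z : ℚ

namespace RatHeisenberg

instance : Mul RatHeisenberg := ⟨fun a b => ⟨a.x + b.x, a.y + b.y, a.z + b.z + a.x * b.y⟩⟩

instance : One RatHeisenberg := ⟨⟨0, 0, 0⟩⟩

instance : Inv RatHeisenberg := ⟨fun a => ⟨-a.x, -a.y, -a.z + a.x * a.y⟩⟩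

@[simp] lemma mul_x (a b : RatHeisenberg) : (a * b).x = a.x + b.x := rfl
@[simp] lemma mul_y (a b : RatHeisenberg) : (a * b).y = a.y + b.y := rfl
@[simp] lemma mul_z (a b : RatHeisenberg) : (a * b).z = a.z + b.z + a.x * b.y := rfl
@[simp] lemma one_x : (1 : RatHeisenberg).x = 0 := rfl
@[simp] lemma one_y : (1 : RatHeisenberg).y = 0 := rfl
@[simp] lemma one_z : (1 : RatHeisenberg).z = 0 := rfl
@[simp] lemma inv_x (a : RatHeisenberg) : (a⁻¹).x = -a.x := rfl
@[simp] lemma inv_y (a : RatHeisenberg) : (a⁻¹).y = -a.y := rfl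
@[simp] lemma inv_z (a : RatHeisenberg) : (a⁻¹).z = -a.z + a.x * a.y := rfl

instance : Group RatHeisenberg :=
  Group.ofLeftAxioms
    (fun a b c => by ext <;> simp <;> ring)
    (fun a => by ext <;> simp)
    (fun a => by ext <;> simp)

lemma commute_iff (a b : RatHeisenberg) : Commute a b ↔ a.x * b.y = b.x * a.y := by
  rw [commute_iff_eq, RatHeisenberg.ext_iff]
  simp only [mul_x, mul_y, mul_z, add_comm a.x, add_comm a.y, true_and]
  constructor <;> intro h <;> linarith

/-- The first coordinate as a homomorphism. -/
def xHom : RatHeisenberg →* Multiplicative ℚ where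
  toFun a := Multiplicative.ofAdd a.x
  map_one' := rfl
  map_mul' _ _ := rfl

/-- The second coordinate as a homomorphism. -/
def yHom : RatHeisenberg →* Multiplicative ℚ where
  toFun a := Multiplicative.ofAdd a.y
  map_one' := rfl
  map_mul' _ _ := rfl

end RatHeisenberg

/-- Two characters of a right-angled Artin group that are proportional along edges lift to the
Heisenberg group, and hence satisfy the commutator relation on any commuting pair. -/
lemma EdgeProportional.raagCharLinear_mul_comm {f g : Fin d → ℚ} (h : EdgeProportional Γ f g)
    {a b : RAAG Γ} (hab : Commute a b) :
    raagCharLinear Γ f a * raagCharLinear Γ g b = raagCharLinear Γ f b * raagCharLinear Γ g a := by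
  let H : RAAG Γ →* RatHeisenberg := raagLift (fun i => ⟨f i, g i, 0⟩) fun i j hij =>
    (RatHeisenberg.commute_iff _ _).mpr (h i j hij)
  have hx : RatHeisenberg.xHom.comp H = raagChar Γ f :=
    raag_hom_ext fun i => by simp [H, raagChar, RatHeisenberg.xHom]
  have hy : RatHeisenberg.yHom.comp H = raagChar Γ g :=
    raag_hom_ext fun i => by simp [H, raagChar, RatHeisenberg.yHom]
  simp only [raagCharLinear_apply, ← hx, ← hy]
  exact (RatHeisenberg.commute_iff _ _).mp (hab.map H)

lemma raagGen_commute {i j : Fin d} (h : Γ.Adj i j) : Commute (raagGen Γ i) (raagGen Γ j) := by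
  have : (PresentedGroup.mk (raagRels Γ))
      ((FreeGroup.of i)⁻¹ * (FreeGroup.of j)⁻¹ * FreeGroup.of i * FreeGroup.of j) = 1 :=
    PresentedGroup.one_of_mem ⟨i, j, h, rfl⟩
  simp only [map_mul, map_inv] at this
  rw [← mul_inv_rev, mul_assoc, inv_mul_eq_one] at this
  exact this.symm

/-- A right-angled Artin group determines its graph. -/
theorem nonempty_iso_of_raag_mulEquiv {Γ' : SimpleGraph (Fin d)} (ψ : RAAG Γ ≃* RAAG Γ') :
    Nonempty (Γ ≃g Γ') := by
  let T : (Fin d → ℚ) ≃ₗ[ℚ] (Fin d → ℚ) :=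
    { toFun := fun f j => raagCharLinear Γ f (ψ.symm (raagGen Γ' j))
      invFun := fun f j => raagCharLinear Γ' f (ψ (raagGen Γ j))
      map_add' := fun f g => by ext; simp
      map_smul' := fun r f => by ext; simp
      left_inv := fun f => by
        ext j
        simpa using raagCharLinear_comp_hom ψ.symm.toMonoidHom f (ψ (raagGen Γ j))
      right_inv := fun f => by
        ext j
        simpa using raagCharLinear_comp_hom ψ.toMonoidHom f (ψ.symm (raagGen Γ' j)) }
  refine nonempty_iso_of_edgeProportional Γ Γ' T fun f g =>
    ⟨fun h i j hij => ?_, fun h i j hij => ?_⟩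
  · exact h.raagCharLinear_mul_comm ((raagGen_commute hij).map ψ.symm)
  · have := h.raagCharLinear_mul_comm ((raagGen_commute hij).map ψ)
    rw [← T.symm_apply_apply f, ← T.symm_apply_apply g]
    exact this

end Raag

section DeltaRaag

variable {d : ℕ} {Γ : SimpleGraph (Fin d)} {φ : Multiplicative (ZMod 2) →* MulAut (RAAG Γ)}

lemma multiplicative_zmod_two_eq (x : Multiplicative (ZMod 2)) :
    x = 1 ∨ x = Multiplicative.ofAdd 1 := by
  revert x
  decide

lemma ofAdd_one_mul_self :
    Multiplicative.ofAdd (1 : ZMod 2) * Multiplicative.ofAdd 1 = 1 := by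
  decide

/-- The sign character of the group of order two. -/
def zmodTwoSign : Multiplicative (ZMod 2) →* ℚ where
  toFun x := if x = 1 then 1 else -1
  map_one' := by simp
  map_mul' x y := by
    have h : Multiplicative.ofAdd (1 : ZMod 2) ≠ 1 := by decide
    rcases multiplicative_zmod_two_eq x with rfl | rfl <;>
      rcases multiplicative_zmod_two_eq y with rfl | rfl <;> simp [ofAdd_one_mul_self, h]

@[simp]
lemma zmodTwoSign_ofAdd_one : zmodTwoSign (Multiplicative.ofAdd 1) = -1 := by
  have h : Multiplicative.ofAdd (1 : ZMod 2) ≠ 1 := by decide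
  simp [zmodTwoSign, h]

lemma zmodTwoSign_injective : Function.Injective zmodTwoSign := by
  intro x y
  rcases multiplicative_zmod_two_eq x with rfl | rfl <;>
    rcases multiplicative_zmod_two_eq y with rfl | rfl <;> simp <;> norm_num

variable (φ) in
/-- The crossed homomorphism, for the sign character of `RAAG Γ ⋊[φ] Δ`, with prescribed values on
the generators of `RAAG Γ` and on the generator of `Δ`. -/
def signCrossedHom : (Fin d → ℚ) × ℚ →ₗ[ℚ] (RAAG Γ ⋊[φ] Multiplicative (ZMod 2) → ℚ) where
  toFun p g := raagCharLinear Γ p.1 g.left + p.2 * ((1 - zmodTwoSign g.right) / 2)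
  map_add' p q := by
    ext g
    simp
    ring
  map_smul' r p := by
    ext g
    simp
    ring

lemma signCrossedHom_apply (p : (Fin d → ℚ) × ℚ) (g : RAAG Γ ⋊[φ] Multiplicative (ZMod 2)) :
    signCrossedHom φ p g =
      raagCharLinear Γ p.1 g.left + p.2 * ((1 - zmodTwoSign g.right) / 2) := rfl

lemma isCrossedHom_signCrossedHom {z : Fin d → RAAG Γ}
    (hz : ∀ i, φ (Multiplicative.ofAdd 1) (raagGen Γ i) = (z i)⁻¹ * (raagGen Γ i)⁻¹ * z i)
    (p : (Fin d → ℚ) × ℚ) :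
    IsCrossedHom (zmodTwoSign.comp SemidirectProduct.rightHom) (signCrossedHom φ p) := by
  have hneg : ∀ a, raagCharLinear Γ p.1 (φ (Multiplicative.ofAdd 1) a) =
      -raagCharLinear Γ p.1 a := by
    have : (raagChar Γ p.1).comp (φ (Multiplicative.ofAdd 1)).toMonoidHom = (raagChar Γ p.1)⁻¹ :=
      raag_hom_ext fun i => by
        simp [hz, mul_comm]
    intro a
    have h := DFunLike.congr_fun this a
    exact congrArg Multiplicative.toAdd h
  intro g h
  simp only [signCrossedHom_apply, SemidirectProduct.mul_left, SemidirectProduct.mul_right,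
    raagCharLinear_mul, map_mul, MonoidHom.comp_apply, SemidirectProduct.rightHom_eq_right]
  rcases multiplicative_zmod_two_eq g.right with hg | hg <;> rw [hg]
  · simp
    ring
  · rw [hneg, zmodTwoSign_ofAdd_one]
    ring

lemma IsCrossedHom.comp_hom {G H : Type*} [Group G] [Group H] {χ : G →* ℚ} {c : G → ℚ}
    (hc : IsCrossedHom χ c) (F : H →* G) : IsCrossedHom (χ.comp F) (c ∘ F) := by
  intro a b
  simp [hc (F a) (F b)]

lemma IsCrossedHom.eq_zero_of_generators {χ : RAAG Γ ⋊[φ] Multiplicative (ZMod 2) →* ℚ}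
    {c : RAAG Γ ⋊[φ] Multiplicative (ZMod 2) → ℚ} (hc : IsCrossedHom χ c)
    (h : ∀ i, c (SemidirectProduct.inl (raagGen Γ i)) = 0)
    (hδ : c (SemidirectProduct.inr (Multiplicative.ofAdd 1)) = 0) : c = 0 := by
  ext g
  rw [← SemidirectProduct.inl_left_mul_inr_right g, hc]
  have h1 := (hc.comp_hom SemidirectProduct.inl).eq_zero_of_raagGen h g.left
  have h2 : c (SemidirectProduct.inr g.right) = 0 := by
    rcases multiplicative_zmod_two_eq g.right with hg | hg <;> rw [hg]
    · rw [_root_.map_one, hc.map_one]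
    · exact hδ
  simp only [Function.comp_apply] at h1
  simp [h1, h2]

/-- If some crossed homomorphism is trivial on `RAAG Γ` but not on `Δ`, then its character is
trivial on `RAAG Γ`. -/
lemma IsCrossedHom.character_inl_eq_one {χ : RAAG Γ ⋊[φ] Multiplicative (ZMod 2) →* ℚ}
    {c : RAAG Γ ⋊[φ] Multiplicative (ZMod 2) → ℚ} (hc : IsCrossedHom χ c)
    (h : ∀ i, c (SemidirectProduct.inl (raagGen Γ i)) = 0)
    (hδ : c (SemidirectProduct.inr (Multiplicative.ofAdd 1)) ≠ 0) (a : RAAG Γ) :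
    χ (SemidirectProduct.inl a) = 1 := by
  have h0 : ∀ a, c (SemidirectProduct.inl a) = 0 :=
    (hc.comp_hom SemidirectProduct.inl).eq_zero_of_raagGen h
  obtain ⟨b, rfl⟩ := (φ (Multiplicative.ofAdd 1)).surjective a
  have key : SemidirectProduct.inr (Multiplicative.ofAdd 1) * SemidirectProduct.inl b =
      SemidirectProduct.inl (φ (Multiplicative.ofAdd 1) b) *
        SemidirectProduct.inr (φ := φ) (Multiplicative.ofAdd 1) := by
    ext <;> simp
  have h1 := congrArg c key
  rw [hc, hc, h0, h0, mul_zero, add_zero, zero_add] at h1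
  exact (mul_eq_right₀ hδ).mp h1.symm

/-- An isomorphism of Δ-RAAGs cannot increase the number of vertices, and preserves the projections
to `Δ` if the numbers of vertices agree. -/
lemma card_le_and_right_eq_of_mulEquiv {d₁ d₂ : ℕ} {Γ₁ : SimpleGraph (Fin d₁)}
    {Γ₂ : SimpleGraph (Fin d₂)} {φ₁ : Multiplicative (ZMod 2) →* MulAut (RAAG Γ₁)}
    {φ₂ : Multiplicative (ZMod 2) →* MulAut (RAAG Γ₂)} {z₂ : Fin d₂ → RAAG Γ₂}
    (hz₂ : ∀ i, φ₂ (Multiplicative.ofAdd 1) (raagGen Γ₂ i) =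
      (z₂ i)⁻¹ * (raagGen Γ₂ i)⁻¹ * z₂ i)
    (Φ : (RAAG Γ₁ ⋊[φ₁] Multiplicative (ZMod 2)) ≃* (RAAG Γ₂ ⋊[φ₂] Multiplicative (ZMod 2))) :
    d₂ ≤ d₁ ∧ (d₂ = d₁ → ∀ g, (Φ g).right = g.right) := by
  have hc := fun p => (isCrossedHom_signCrossedHom hz₂ p).comp_hom Φ.toMonoidHom
  let L : (Fin d₂ → ℚ) × ℚ →ₗ[ℚ] (Fin d₁ → ℚ) × ℚ :=
    { toFun := fun p => (fun i => signCrossedHom φ₂ p (Φ (SemidirectProduct.inl (raagGen Γ₁ i))),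
        signCrossedHom φ₂ p (Φ (SemidirectProduct.inr (Multiplicative.ofAdd 1))))
      map_add' := fun p q => by ext <;> simp
      map_smul' := fun r p => by ext <;> simp }
  have hL : Function.Injective L := by
    rw [injective_iff_map_eq_zero]
    intro p hp
    have h0 := (hc p).eq_zero_of_generators (congrFun (congrArg Prod.fst hp))
      (congrArg Prod.snd hp)
    have h1 : ∀ g, signCrossedHom φ₂ p g = 0 := fun g => by
      simpa using congrFun h0 (Φ.symm g)
    ext i
    · simpa [signCrossedHom_apply] using h1 (SemidirectProduct.inl (raagGen Γ₂ i))
    · simpa [signCrossedHom_apply, raagCharLinear_apply] using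
        h1 (SemidirectProduct.inr (Multiplicative.ofAdd 1))
  refine ⟨?_, fun hd => ?_⟩
  · simpa using LinearMap.finrank_le_finrank_of_injective hL
  · have hsurj : Function.Surjective L :=
      (LinearMap.injective_iff_surjective_of_finrank_eq_finrank (by simp [hd])).mp hL
    obtain ⟨p, hp⟩ := hsurj (0, 1)
    have hA := (hc p).character_inl_eq_one (congrFun (congrArg Prod.fst hp))
      (by
        have := congrArg Prod.snd hp
        exact fun h => one_ne_zero (this.symm.trans h))
    have hA' : ∀ a, (Φ (SemidirectProduct.inl a)).right = 1 := fun a =>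
      zmodTwoSign_injective (by simpa using hA a)
    have hδ : (Φ (SemidirectProduct.inr (Multiplicative.ofAdd 1))).right =
        Multiplicative.ofAdd 1 := by
      refine (multiplicative_zmod_two_eq _).resolve_left fun h => ?_
      have hall : ∀ g, (Φ g).right = 1 := by
        intro g
        rw [← SemidirectProduct.inl_left_mul_inr_right g, map_mul, SemidirectProduct.mul_right, hA',
          one_mul]
        rcases multiplicative_zmod_two_eq g.right with hg | hg <;> rw [hg]
        · simp
        · exact h
      have := hall (Φ.symm (SemidirectProduct.inr (Multiplicative.ofAdd 1)))
      simp at this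
    intro g
    conv_lhs => rw [← SemidirectProduct.inl_left_mul_inr_right g]
    rw [map_mul, SemidirectProduct.mul_right, hA', one_mul]
    rcases multiplicative_zmod_two_eq g.right with hg | hg <;> rw [hg]
    · simp
    · exact hδ

/-- An isomorphism of semidirect products compatible with the projections restricts to an
isomorphism of the normal factors. -/
def SemidirectProduct.leftEquivOfRightEq {N₁ N₂ H : Type*} [Group N₁] [Group N₂] [Group H]
    {φ₁ : H →* MulAut N₁} {φ₂ : H →* MulAut N₂} (Φ : (N₁ ⋊[φ₁] H) ≃* (N₂ ⋊[φ₂] H))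
    (h : ∀ g, (Φ g).right = g.right) : N₁ ≃* N₂ where
  toFun a := (Φ (inl a)).left
  invFun b := (Φ.symm (inl b)).left
  left_inv a := by
    have : inl (Φ (inl a)).left = Φ (inl a) := by ext <;> simp [h]
    simp [this]
  right_inv b := by
    have hs : (Φ.symm (inl b)).right = 1 := by
      rw [← h]
      simp
    have : inl (Φ.symm (inl b)).left = Φ.symm (inl b) := by ext <;> simp [hs]
    simp [this]
  map_mul' a b := by simp [h]

end DeltaRaag

/-- if two Δ-RAAGs `G_{z₁} = A(Γ₁) ⋊[φ₁] Δ` and `G_{z₂} = A(Γ₂) ⋊[φ₂] Δ`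
are isomorphic as groups, then the underlying graphs `Γ₁` and `Γ₂` are isomorphic. -/
theorem stmt_8 {d₁ d₂ : ℕ} (Γ₁ : SimpleGraph (Fin d₁)) (Γ₂ : SimpleGraph (Fin d₂))
    (z₁ : Fin d₁ → RAAG Γ₁) (z₂ : Fin d₂ → RAAG Γ₂)
    (δ₁ : MulAut (RAAG Γ₁)) (δ₂ : MulAut (RAAG Γ₂))
    (hδ₁2 : δ₁ * δ₁ = 1) (hδ₂2 : δ₂ * δ₂ = 1)
    (hδ₁ : ∀ i : Fin d₁, δ₁ (raagGen Γ₁ i) = (z₁ i)⁻¹ * (raagGen Γ₁ i)⁻¹ * z₁ i)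
    (hδ₂ : ∀ i : Fin d₂, δ₂ (raagGen Γ₂ i) = (z₂ i)⁻¹ * (raagGen Γ₂ i)⁻¹ * z₂ i)
    (φ₁ : Multiplicative (ZMod 2) →* MulAut (RAAG Γ₁))
    (φ₂ : Multiplicative (ZMod 2) →* MulAut (RAAG Γ₂))
    (hφ₁ : φ₁ (Multiplicative.ofAdd 1) = δ₁)
    (hφ₂ : φ₂ (Multiplicative.ofAdd 1) = δ₂)
    (hiso : Nonempty ((RAAG Γ₁ ⋊[φ₁] Multiplicative (ZMod 2)) ≃*
      (RAAG Γ₂ ⋊[φ₂] Multiplicative (ZMod 2)))) :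
    Nonempty (Γ₁ ≃g Γ₂) := by
  subst hφ₁ hφ₂
  obtain ⟨Φ⟩ := hiso
  have h := card_le_and_right_eq_of_mulEquiv hδ₂ Φ
  have hd : d₂ = d₁ := le_antisymm h.1 (card_le_and_right_eq_of_mulEquiv hδ₁ Φ.symm).1
  subst hd
  exact nonempty_iso_of_raag_mulEquiv (SemidirectProduct.leftEquivOfRightEq Φ (h.2 rfl))
end

section
/- Let A be the associative F₂-algebra presented by generators e₀,e₁,e₂,e₃,e₄ and relations e₀e_i = e_ie₀ (1 ≤ i ≤ 4), e_ie_j = e_je_i (1 ≤ i < j ≤ 4), e₀e_i = e_i² (1 ≤ i ≤ 4), e₁e₃ = 0 and e₂e₄ = 0 (i.e. the quotient of the free associative F₂-algebra on e₀,…,e₄ by the two-sided ideal generated by these differences and products). Then the fifteen elements 1, e₀, e₁, e₂, e₃, e₄, e₀², e₀e₁, e₀e₂, e₀e₃, e₀e₄, e₁e₂, e₁e₄, e₃e₂, e₃e₄ are F₂-linearly independent in A, and every product e_u·e_v of two generators (0 ≤ u,v ≤ 4) lies in the F₂-linear span of the nine quadratic elements e₀², e₀e₁, e₀e₂, e₀e₃,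 e₀e₄, e₁e₂, e₁e₄, e₃e₂, e₃e₄. -/
/-- The defining relations of the algebra `A`: `e₀eᵢ = eᵢe₀` (`1 ≤ i ≤ 4`),
`eᵢeⱼ = eⱼeᵢ` (`1 ≤ i < j ≤ 4`), `e₀eᵢ = eᵢ²` (`1 ≤ i ≤ 4`), `e₁e₃ = 0`, `e₂e₄ = 0`. -/
inductive ARel : FreeAlgebra (ZMod 2) (Fin 5) → FreeAlgebra (ZMod 2) (Fin 5) → Prop
  | comm0 (i : Fin 5) (hi : i ≠ 0) :
      ARel (FreeAlgebra.ι (ZMod 2) 0 * FreeAlgebra.ι (ZMod 2) i)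
        (FreeAlgebra.ι (ZMod 2) i * FreeAlgebra.ι (ZMod 2) 0)
  | comm (i j : Fin 5) (hi : i ≠ 0) (hj : j ≠ 0) (hij : i < j) :
      ARel (FreeAlgebra.ι (ZMod 2) i * FreeAlgebra.ι (ZMod 2) j)
        (FreeAlgebra.ι (ZMod 2) j * FreeAlgebra.ι (ZMod 2) i)
  | sq (i : Fin 5) (hi : i ≠ 0) :
      ARel (FreeAlgebra.ι (ZMod 2) 0 * FreeAlgebra.ι (ZMod 2) i)
        (FreeAlgebra.ι (ZMod 2) i * FreeAlgebra.ι (ZMod 2) i)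
  | rel13 : ARel (FreeAlgebra.ι (ZMod 2) 1 * FreeAlgebra.ι (ZMod 2) 3) 0
  | rel24 : ARel (FreeAlgebra.ι (ZMod 2) 2 * FreeAlgebra.ι (ZMod 2) 4) 0

/-- The associative `𝔽₂`-algebra `A` presented by generators `e₀,…,e₄` and the relations
`ARel`. -/
abbrev A : Type := RingQuot ARel

/-- The generator `eᵢ` of `A`. -/
noncomputable def e (i : Fin 5) : A :=
  RingQuot.mkAlgHom (ZMod 2) ARel (FreeAlgebra.ι (ZMod 2) i)


/-- The product `eᵢeⱼ` in coordinates: `(i, j) ↦ 1` marks the quadratic monomial `eᵢeⱼ` with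
`i ≤ j`, except that `eᵢ²` is recorded as `e₀eᵢ`. -/
def quadProd (i j : Fin 5) : Fin 5 × Fin 5 → ZMod 2 :=
  if min i j ≠ 0 ∧ max i j = min i j + 2 then 0
  else if i = j then Pi.single (0, i) 1
  else Pi.single (min i j, max i j) 1

/-- The underlying space of `A` truncated above degree two. -/
abbrev TruncSpace : Type := ZMod 2 × (Fin 5 → ZMod 2) × (Fin 5 × Fin 5 → ZMod 2)

/-- Left multiplication by the generator `eᵢ` on the truncation. -/
noncomputable def mulGen (i : Fin 5) : Module.End (ZMod 2) TruncSpace where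
  toFun x := (0, x.1 • Pi.single i 1, ∑ j, x.2.1 j • quadProd i j)
  map_add' x y := by simp [add_smul, Finset.sum_add_distrib]
  map_smul' c x := by simp [mul_smul, Finset.smul_sum]

theorem mulGen_mul_apply (i j : Fin 5) (x : TruncSpace) :
    (mulGen i * mulGen j) x = (0, 0, x.1 • quadProd i j) := by
  simp [mulGen, Pi.single_apply]

theorem mulGen_mul_congr {i j k l : Fin 5} (h : quadProd i j = quadProd k l) :
    mulGen i * mulGen j = mulGen k * mulGen l :=
  LinearMap.ext fun x => by rw [mulGen_mul_apply, mulGen_mul_apply, h]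

theorem mulGen_mul_eq_zero {i j : Fin 5} (h : quadProd i j = 0) : mulGen i * mulGen j = 0 :=
  LinearMap.ext fun x => by rw [mulGen_mul_apply, h]; simp

theorem quadProd_comm (i j : Fin 5) : quadProd i j = quadProd j i := by
  revert i j; decide

theorem quadProd_zero_left (i : Fin 5) : quadProd 0 i = quadProd i i := by
  revert i; decide

/-- The action of `A` on its truncation. -/
noncomputable def truncRep : A →ₐ[ZMod 2] Module.End (ZMod 2) TruncSpace :=
  RingQuot.liftAlgHom (ZMod 2) ⟨FreeAlgebra.lift (ZMod 2) mulGen, by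
    intro x y h
    cases h with
    | comm0 i => simpa using mulGen_mul_congr (quadProd_comm 0 i)
    | comm i j => simpa using mulGen_mul_congr (quadProd_comm i j)
    | sq i => simpa using mulGen_mul_congr (quadProd_zero_left i)
    | rel13 => simpa using mulGen_mul_eq_zero (i := 1) (j := 3) (by decide)
    | rel24 => simpa using mulGen_mul_eq_zero (i := 2) (j := 4) (by decide)⟩

theorem truncRep_e (i : Fin 5) : truncRep (e i) = mulGen i := by
  simp [truncRep, e]

/-- The orbit map at the class of `1`. -/
noncomputable def truncation : A →ₗ[ZMod 2] TruncSpace :=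
  LinearMap.applyₗ ((1, 0, 0) : TruncSpace) ∘ₗ truncRep.toLinearMap

theorem truncation_one : truncation 1 = (1, 0, 0) := by
  simp [truncation]

theorem truncation_e (i : Fin 5) : truncation (e i) = (0, Pi.single i 1, 0) := by
  simp [truncation, truncRep_e, mulGen]

theorem truncation_e_mul_e (i j : Fin 5) : truncation (e i * e j) = (0, 0, quadProd i j) := by
  simp only [truncation, LinearMap.comp_apply, AlgHom.toLinearMap_apply, map_mul, truncRep_e,
    LinearMap.applyₗ_apply_apply, mulGen_mul_apply, one_smul]

theorem e_mul_comm (i j : Fin 5) : e i * e j = e j * e i := by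
  have of_lt : ∀ i j : Fin 5, i < j → e i * e j = e j * e i := by
    intro i j h
    have hj : j ≠ 0 := by rintro rfl; simp at h
    by_cases hi : i = 0
    · subst hi
      simpa [e] using RingQuot.mkAlgHom_rel (ZMod 2) (ARel.comm0 j hj)
    · simpa [e] using RingQuot.mkAlgHom_rel (ZMod 2) (ARel.comm i j hi hj h)
  rcases lt_trichotomy i j with h | rfl | h
  · exact of_lt i j h
  · rfl
  · exact (of_lt j i h).symm

theorem e_mul_self (i : Fin 5) : e i * e i = e 0 * e i := by
  by_cases hi : i = 0
  · rw [hi]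
  · simpa [e] using (RingQuot.mkAlgHom_rel (ZMod 2) (ARel.sq i hi)).symm

theorem e_one_mul_e_three : e 1 * e 3 = 0 := by
  simpa [e] using RingQuot.mkAlgHom_rel (ZMod 2) ARel.rel13

theorem e_two_mul_e_four : e 2 * e 4 = 0 := by
  simpa [e] using RingQuot.mkAlgHom_rel (ZMod 2) ARel.rel24

/-- in the `𝔽₂`-algebra `A` presented by `e₀,…,e₄` with relations
`e₀eᵢ = eᵢe₀`, `eᵢeⱼ = eⱼeᵢ`, `e₀eᵢ = eᵢ²`, `e₁e₃ = 0 = e₂e₄`, the fifteen elements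
`1, e₀, …, e₄, e₀², e₀e₁, …, e₀e₄, e₁e₂, e₁e₄, e₃e₂, e₃e₄` are linearly independent,
and every product of two generators lies in the span of the nine quadratic ones. -/
theorem stmt_10 :
    LinearIndependent (ZMod 2)
      ![(1 : A), e 0, e 1, e 2, e 3, e 4,
        e 0 * e 0, e 0 * e 1, e 0 * e 2, e 0 * e 3, e 0 * e 4,
        e 1 * e 2, e 1 * e 4, e 3 * e 2, e 3 * e 4] ∧
    ∀ u v : Fin 5, e u * e v ∈ Submodule.span (ZMod 2)
      ({e 0 * e 0, e 0 * e 1, e 0 * e 2, e 0 * e 3, e 0 * e 4,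
        e 1 * e 2, e 1 * e 4, e 3 * e 2, e 3 * e 4} : Set A) := by
  constructor
  · refine LinearIndependent.of_comp truncation ?_
    rw [Fintype.linearIndependent_iff]
    intro g h
    simp only [Function.comp_apply, Fin.sum_univ_succ, Fin.sum_univ_zero, Matrix.cons_val_zero,
      Matrix.cons_val_succ, truncation_one, truncation_e, truncation_e_mul_e] at h
    have h0 := congrArg Prod.fst h
    have h1 (i : Fin 5) := congrFun (congrArg (fun x => x.2.1) h) i
    have h2 (i j : Fin 5) := congrFun (congrArg (fun x => x.2.2) h) (i, j)
    simp only [quadProd] at h2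
    intro k
    fin_cases k
    · simpa using h0
    · simpa using h1 0
    · simpa using h1 1
    · simpa using h1 2
    · simpa using h1 3
    · simpa using h1 4
    · simpa using h2 0 0
    · simpa using h2 0 1
    · simpa using h2 0 2
    · simpa using h2 0 3
    · simpa using h2 0 4
    · simpa using h2 1 2
    · simpa using h2 1 4
    · simpa using h2 2 3
    · simpa using h2 3 4
  · have key : ∀ u v : Fin 5, u ≤ v → e u * e v ∈ Submodule.span (ZMod 2)
        ({e 0 * e 0, e 0 * e 1, e 0 * e 2, e 0 * e 3, e 0 * e 4,
          e 1 * e 2, e 1 * e 4, e 3 * e 2, e 3 * e 4} : Set A) := by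
      intro u v huv
      by_cases h : u = v
      · rw [h, e_mul_self v]
        apply Submodule.subset_span
        fin_cases v <;> simp
      · fin_cases u <;> fin_cases v <;> first
          | exact absurd huv (by decide)
          | exact absurd rfl h
          | (apply Submodule.subset_span; simp; done)
          | (apply Submodule.subset_span; simp [e_mul_comm 2 3]; done)
          | simp [e_one_mul_e_three, e_two_mul_e_four]
    intro u v
    rcases le_total u v with h | h
    · exact key u v h
    · rw [e_mul_comm u v]; exact key v u h
end

section
/- Let A be the associative F₂-algebra presented by generators e₀,e₁,e₂,e₃,e₄ and relations e₀e_i = e_ie₀ (1 ≤ i ≤ 4), e_ie_j = e_je_i (1 ≤ i < j ≤ 4), e₀e_i = e_i² (1 ≤ i ≤ 4), e₁e₃ = 0 and e₂e₄ = 0. Let (a,b₁,b₂,b₃,b₄) and (a',b₁',b₂',b₃',b₄') be nonzero vectors in F₂⁵ and set α := a·e₀ + b₁e₁ + b₂e₂ + b₃e₃ + b₄e₄ and α' := a'·e₀ + b₁'e₁ + b₂'e₂ + b₃'e₃ + b₄'e₄. If α·α' = 0 in A, then at least one of the following holds: (i) b₂ = b₄ = b₂' = b₄' = 0 and (b₁,b₃)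 ≠ (0,0) ≠ (b₁',b₃') (so α and α' lie in the span of {e₀,e₁,e₃} and neither equals e₀); (ii) b₁ = b₃ = b₁' = b₃' = 0 and (b₂,b₄) ≠ (0,0) ≠ (b₂',b₄') (so α and α' lie in the span of {e₀,e₂,e₄} and neither equals e₀); (iii) (b₁,b₃) ≠ (0,0) ≠ (b₂,b₄), (b₁',b₃') ≠ (0,0) ≠ (b₂',b₄'), and (a',b₁',b₂',b₃',b₄') = (a+1,b₁,b₂,b₃,b₄), i.e. α' = α + e₀. -/
/-- A vector `v` over `𝔽₂` with `v₀ = 1`, `v₁v₃ = 0` and `v₂v₄ = 0` defines a point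
`A → 𝔽₂`, `eᵢ ↦ vᵢ`, of the algebra `A`. -/
noncomputable def evalA (v : Fin 5 → ZMod 2) (h0 : v 0 = 1) (h13 : v 1 * v 3 = 0)
    (h24 : v 2 * v 4 = 0) : A →ₐ[ZMod 2] ZMod 2 :=
  RingQuot.liftAlgHom (ZMod 2) ⟨FreeAlgebra.lift (ZMod 2) v, by
    have sq_self : ∀ x : ZMod 2, x = x * x := by decide
    rintro _ _ (⟨i, -⟩ | ⟨i, j, -, -, -⟩ | ⟨i, -⟩ | _ | _)
    · simp [mul_comm]
    · simp [mul_comm]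
    · simpa [h0] using sq_self (v i)
    · simpa using h13
    · simpa using h24⟩

theorem evalA_e (v : Fin 5 → ZMod 2) (h0 : v 0 = 1) (h13 : v 1 * v 3 = 0)
    (h24 : v 2 * v 4 = 0) (i : Fin 5) : evalA v h0 h13 h24 (e i) = v i := by
  simp [evalA, e]

/-- in the algebra `A` (the mod-2 cohomology ring of the paper's group),
if `α = a·e₀ + b₁e₁ + ⋯ + b₄e₄` and `α' = a'·e₀ + b₁'e₁ + ⋯ + b₄'e₄` are given by nonzero
coefficient vectors and `α·α' = 0`, then either both lie in the span of `{e₀,e₁,e₃}`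
and neither equals `e₀`, or both lie in the span of `{e₀,e₂,e₄}` and neither equals `e₀`,
or neither lies in either span and `α' = α + e₀`. -/
theorem stmt_11 (a b1 b2 b3 b4 a' b1' b2' b3' b4' : ZMod 2)
    (h : ¬(a = 0 ∧ b1 = 0 ∧ b2 = 0 ∧ b3 = 0 ∧ b4 = 0))
    (h' : ¬(a' = 0 ∧ b1' = 0 ∧ b2' = 0 ∧ b3' = 0 ∧ b4' = 0))
    (hmul : (a • e 0 + b1 • e 1 + b2 • e 2 + b3 • e 3 + b4 • e 4) *
        (a' • e 0 + b1' • e 1 + b2' • e 2 + b3' • e 3 + b4' • e 4) = 0) :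
    (b2 = 0 ∧ b4 = 0 ∧ b2' = 0 ∧ b4' = 0 ∧
      ¬(b1 = 0 ∧ b3 = 0) ∧ ¬(b1' = 0 ∧ b3' = 0)) ∨
    (b1 = 0 ∧ b3 = 0 ∧ b1' = 0 ∧ b3' = 0 ∧
      ¬(b2 = 0 ∧ b4 = 0) ∧ ¬(b2' = 0 ∧ b4' = 0)) ∨
    (¬(b1 = 0 ∧ b3 = 0) ∧ ¬(b2 = 0 ∧ b4 = 0) ∧
      ¬(b1' = 0 ∧ b3' = 0) ∧ ¬(b2' = 0 ∧ b4' = 0) ∧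
      a' = a + 1 ∧ b1' = b1 ∧ b2' = b2 ∧ b3' = b3 ∧ b4' = b4) := by
  have key : ∀ v1 v2 v3 v4 : ZMod 2, v1 * v3 = 0 → v2 * v4 = 0 →
      (a + b1 * v1 + b2 * v2 + b3 * v3 + b4 * v4) *
        (a' + b1' * v1 + b2' * v2 + b3' * v3 + b4' * v4) = 0 := by
    intro v1 v2 v3 v4 h13 h24
    have eval_e := evalA_e ![1, v1, v2, v3, v4] rfl h13 h24
    have := congrArg (evalA ![1, v1, v2, v3, v4] rfl h13 h24) hmul
    simpa only [map_mul, map_add, map_smul, map_zero, eval_e, smul_eq_mul, Matrix.cons_val,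
      mul_one] using this
  clear hmul
  revert a b1 b2 b3 b4 a' b1' b2' b3' b4'
  set_option synthInstance.maxSize 1000 in
  decide +kernel
end
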